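/- arXiv:math/0411216 — 2 statements merged into one kernel-verified Lean document; each statement's English description precedes it below -/
import Mathlib

section
/- Let n ≥ 3 and let μ be a nonnegative locally finite Borel measure on ℝⁿ satisfying the trace inequality ∫ |u|² dμ ≤ C ‖∇u‖²_{L²} for all u ∈ C_c^∞(ℝⁿ). Then there exists a constant C' (depending only on C and n) such that μ(B(x,r)) ≤ C' r^{n-2} for all x ∈ ℝⁿ and r > 0. -/
open MeasureTheory

noncomputable section

/-- Euclidean space ℝⁿ. -/
abbrev V (n : ℕ) := EuclideanSpace ℝ (Fin n)

/-- `u` is a smooth compactly supported (complex-valued) test function. -/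
def IsTest {n : ℕ} (u : V n → ℂ) : Prop := ContDiff ℝ (⊤ : ℕ∞) u ∧ HasCompactSupport u

/-- The Dirichlet (homogeneous Sobolev) norm `‖∇u‖_{L²(ℝⁿ)}`. -/
noncomputable def gradNorm {n : ℕ} (u : V n → ℂ) : ℝ :=
  (∫ x : V n, ‖fderiv ℝ u x‖ ^ 2) ^ ((1 : ℝ) / 2)

/-- There is a test function with `‖u‖ ≥ 1` on the open unit ball. -/
lemma exists_isTest_one_le_norm (n : ℕ) :
    ∃ u : V n → ℂ, IsTest u ∧ ∀ y ∈ Metric.ball (0 : V n) 1, 1 ≤ ‖u y‖ := by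
  let f : ContDiffBump (0 : V n) := ⟨1, 2, one_pos, one_lt_two⟩
  refine ⟨fun y => (f y : ℂ), ⟨Complex.ofRealCLM.contDiff.comp f.contDiff, ?_⟩, ?_⟩
  · exact f.hasCompactSupport.comp_left (g := fun t : ℝ => (t : ℂ)) Complex.ofReal_zero
  · intro y hy
    have hf : f y = 1 := f.one_of_mem_closedBall (Metric.ball_subset_closedBall hy)
    simp [hf]

/-- Test functions are preserved by translation and dilation. -/
lemma IsTest.comp_smul_sub {n : ℕ} {u : V n → ℂ} (hu : IsTest u) (x : V n) {c : ℝ} (hc : c ≠ 0) :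
    IsTest fun y => u (c • (y - x)) := by
  refine ⟨hu.1.comp ((contDiff_id.sub contDiff_const).const_smul c), ?_⟩
  exact hu.2.comp_homeomorph ((Homeomorph.subRight x).trans (Homeomorph.smulOfNeZero c hc))

/-- Scaling of the Dirichlet energy. -/
lemma integral_norm_fderiv_sq_comp_smul_sub {n : ℕ} (u : V n → ℂ) (x : V n)
    {r : ℝ} (hr : 0 < r) :
    ∫ y : V n, ‖fderiv ℝ (fun z => u (r⁻¹ • (z - x))) y‖ ^ 2 =
      (∫ y : V n, ‖fderiv ℝ u y‖ ^ 2) * r ^ ((n : ℝ) - 2) := by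
  have hderiv (y : V n) : ‖fderiv ℝ (fun z => u (r⁻¹ • (z - x))) y‖ ^ 2 =
      r⁻¹ ^ 2 * ‖fderiv ℝ u (r⁻¹ • (y - x))‖ ^ 2 := by
    rw [fderiv_comp_sub (f := fun z => u (r⁻¹ • z)), fderiv_comp_smul, norm_smul, mul_pow,
      Real.norm_eq_abs, sq_abs]
  simp_rw [hderiv]
  rw [integral_const_mul,
    integral_sub_right_eq_self (fun y : V n => ‖fderiv ℝ u (r⁻¹ • y)‖ ^ 2) x,
    Measure.integral_comp_inv_smul_of_nonneg volume (fun y : V n => ‖fderiv ℝ u y‖ ^ 2) hr.le,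
    finrank_euclideanSpace_fin, smul_eq_mul, Real.rpow_sub hr, Real.rpow_natCast,
    Real.rpow_ofNat]
  field_simp

/-- Markov-type bound: a test function of modulus at least one on `s` controls `μ s`. -/
lemma IsTest.measure_le_ofReal_integral {n : ℕ} {u : V n → ℂ} (hu : IsTest u)
    (μ : Measure (V n)) [IsLocallyFiniteMeasure μ] {s : Set (V n)} (hs : MeasurableSet s)
    (h : ∀ y ∈ s, 1 ≤ ‖u y‖) : μ s ≤ ENNReal.ofReal (∫ y, ‖u y‖ ^ 2 ∂μ) := by
  have hcont : Continuous fun y => ‖u y‖ ^ 2 := hu.1.continuous.norm.pow 2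
  have hint : Integrable (fun y => ‖u y‖ ^ 2) μ := by
    refine hcont.integrable_of_hasCompactSupport ?_
    exact hu.2.comp_left (g := fun z : ℂ => ‖z‖ ^ 2) (by simp)
  rw [ofReal_integral_eq_lintegral_ofReal hint (Filter.Eventually.of_forall fun y => by positivity),
    ← lintegral_indicator_one hs]
  refine lintegral_mono fun y => ?_
  refine Set.indicator_apply_le' (fun hy => ?_) fun _ => zero_le
  exact ENNReal.one_le_ofReal.2 (one_le_pow₀ (h y hy))

/-- If `n ≥ 3` and a nonnegative locally finite Borel measure `μ` on `ℝⁿ`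
satisfies the trace inequality `∫ |u|² dμ ≤ C ‖∇u‖²_{L²}` for all test functions `u`, then
`μ(B(x,r)) ≤ C' rⁿ⁻²` for a constant `C'` depending only on `C` and `n`. -/
theorem stmt_0 (n : ℕ) (hn : 3 ≤ n) (C : ℝ) :
    ∃ C' : ℝ, ∀ (μ : Measure (V n)), IsLocallyFiniteMeasure μ →
      (∀ u : V n → ℂ, IsTest u →
        ∫ x, ‖u x‖ ^ 2 ∂μ ≤ C * ∫ x : V n, ‖fderiv ℝ u x‖ ^ 2) →
      ∀ (x : V n) (r : ℝ), 0 < r →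
        μ (Metric.ball x r) ≤ ENNReal.ofReal (C' * r ^ ((n : ℝ) - 2)) := by
  obtain ⟨u, hu, hone⟩ := exists_isTest_one_le_norm n
  refine ⟨C * ∫ y : V n, ‖fderiv ℝ u y‖ ^ 2, fun μ _ htrace x r hr => ?_⟩
  have hv := hu.comp_smul_sub x (inv_ne_zero hr.ne')
  refine (hv.measure_le_ofReal_integral μ Metric.isOpen_ball.measurableSet fun y hy => ?_).trans
    (ENNReal.ofReal_le_ofReal ?_)
  · refine hone _ ?_
    rw [mem_ball_zero_iff, norm_smul, norm_inv, Real.norm_of_nonneg hr.le, ← dist_eq_norm,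
      inv_mul_lt_one₀ hr]
    exact hy
  · refine (htrace _ hv).trans_eq ?_
    rw [integral_norm_fderiv_sq_comp_smul_sub u x hr, mul_assoc]
end
end

section
/- Let n ∈ {1, 2} and let μ be a nonnegative locally finite Borel measure on ℝⁿ satisfying ∫ |u|² dμ ≤ C ‖∇u‖²_{L²(ℝⁿ)} for all u ∈ C_c^∞(ℝⁿ). Then μ = 0. -/
open MeasureTheory

noncomputable section

theorem IsTest.continuous {n : ℕ} {u : V n → ℂ} (hu : IsTest u) : Continuous u :=
  hu.1.continuous

theorem IsTest.differentiable {n : ℕ} {u : V n → ℂ} (hu : IsTest u) : Differentiable ℝ u :=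
  hu.1.differentiable (by simp)

theorem HasCompactSupport.integrable_norm_sq {X E : Type*} [TopologicalSpace X]
    [MeasurableSpace X] [OpensMeasurableSpace X] [NormedAddCommGroup E] {f : X → E}
    (hf : HasCompactSupport f) (hc : Continuous f) (μ : Measure X) [IsFiniteMeasureOnCompacts μ] :
    Integrable (fun x => ‖f x‖ ^ 2) μ := by
  refine Continuous.integrable_of_hasCompactSupport (by fun_prop) (hf.mono fun x hx => ?_)
  simpa using hx

theorem IsTest.integrable_norm_sq {n : ℕ} {u : V n → ℂ} (hu : IsTest u) (μ : Measure (V n))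
    [IsLocallyFiniteMeasure μ] : Integrable (fun x => ‖u x‖ ^ 2) μ :=
  hu.2.integrable_norm_sq hu.continuous μ

theorem IsTest.integrable_norm_fderiv_sq {n : ℕ} {u : V n → ℂ} (hu : IsTest u) :
    Integrable (fun x => ‖fderiv ℝ u x‖ ^ 2) :=
  (hu.2.fderiv (𝕜 := ℝ)).integrable_norm_sq (hu.1.continuous_fderiv (by simp)) volume

theorem IsTest.comp_smul {n : ℕ} {u : V n → ℂ} (hu : IsTest u) {c : ℝ} (hc : c ≠ 0) :
    IsTest fun x => u (c • x) :=
  ⟨hu.1.comp (contDiff_const_smul c), hu.2.comp_smul hc⟩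

theorem IsTest.const_smul {n : ℕ} {u : V n → ℂ} (hu : IsTest u) (c : ℝ) :
    IsTest fun x => c • u x :=
  ⟨hu.1.const_smul c, hu.2.comp_left (g := fun z : ℂ => c • z) (by simp)⟩

theorem IsTest.sum {n : ℕ} {ι : Type*} {s : Finset ι} {u : ι → V n → ℂ}
    (hu : ∀ i ∈ s, IsTest (u i)) : IsTest fun x => ∑ i ∈ s, u i x := by
  classical
  refine ⟨ContDiff.sum fun i hi => (hu i hi).1, ?_⟩
  induction s using Finset.induction_on with
  | empty => exact HasCompactSupport.zero
  | insert a s ha ih =>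
    simp only [Finset.sum_insert ha]
    exact (hu a (by simp)).2.add (ih fun i hi => hu i (by simp [hi]))

/-- In dimension at most two, spreading a function out does not increase its Dirichlet energy. -/
theorem integral_norm_fderiv_sq_comp_inv_smul_le {n : ℕ} (hn : n ≤ 2) (u : V n → ℂ) {c : ℝ}
    (hc : 1 ≤ c) :
    ∫ x : V n, ‖fderiv ℝ (fun y => u (c⁻¹ • y)) x‖ ^ 2 ≤ ∫ x : V n, ‖fderiv ℝ u x‖ ^ 2 := by
  have hc0 : 0 < c := by linarith
  have hE : 0 ≤ ∫ x : V n, ‖fderiv ℝ u x‖ ^ 2 := integral_nonneg fun x => by positivity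
  simp_rw [fderiv_comp_smul, norm_smul, mul_pow]
  rw [integral_const_mul,
    Measure.integral_comp_smul volume (fun x => ‖fderiv ℝ u x‖ ^ 2) c⁻¹, smul_eq_mul, ← mul_assoc]
  refine mul_le_of_le_one_left hE ?_
  have h : c ^ n ≤ c ^ 2 := pow_le_pow_right₀ hc hn
  rw [finrank_euclideanSpace_fin, inv_pow, inv_inv, abs_of_pos (by positivity), Real.norm_eq_abs,
    abs_of_pos (by positivity), inv_pow, inv_mul_le_iff₀ (by positivity)]
  simpa using h

theorem norm_sum_sq_le_of_pairwise_eq_zero {ι E : Type*} [SeminormedAddCommGroup E]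
    (s : Finset ι) (v : ι → E) (hv : ∀ i ∈ s, ∀ j ∈ s, i ≠ j → v i = 0 ∨ v j = 0) :
    ‖∑ i ∈ s, v i‖ ^ 2 ≤ ∑ i ∈ s, ‖v i‖ ^ 2 := by
  by_cases h : ∀ i ∈ s, v i = 0
  · rw [Finset.sum_eq_zero h]
    simpa using Finset.sum_nonneg fun i _ => sq_nonneg ‖v i‖
  · push Not at h
    obtain ⟨i, hi, hvi⟩ := h
    rw [Finset.sum_eq_single_of_mem i hi
      fun j hj hji => (hv i hi j hj hji.symm).resolve_left hvi]
    exact Finset.single_le_sum (f := fun i => ‖v i‖ ^ 2) (fun j _ => by positivity) hi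

/-- A radial cutoff equal to `1` on the unit ball and vanishing outside the ball of radius `2`. -/
theorem exists_isTest_cutoff (n : ℕ) : ∃ φ : V n → ℂ, IsTest φ ∧
    (∀ x, ‖x‖ ≤ 1 → φ x = 1) ∧ ∀ x, fderiv ℝ φ x ≠ 0 → 1 ≤ ‖x‖ ∧ ‖x‖ ≤ 2 := by
  let f : ContDiffBump (0 : V n) := ⟨1, 2, one_pos, one_lt_two⟩
  have h1 : ∀ x, ‖x‖ ≤ 1 → ((f x : ℝ) : ℂ) = 1 := fun x hx => by
    rw [f.one_of_mem_closedBall (by simpa [f] using hx)]; simp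
  refine ⟨fun x => (f x : ℂ),
    ⟨Complex.ofRealCLM.contDiff.comp f.contDiff,
      f.hasCompactSupport.comp_left (g := fun r : ℝ => (r : ℂ)) (by simp)⟩, h1, ?_⟩
  intro x hx
  constructor <;> by_contra! h
  · apply hx
    have : (fun x => ((f x : ℝ) : ℂ)) =ᶠ[nhds x] fun _ => 1 := by
      filter_upwards [continuous_norm.continuousAt.eventually_lt_const h] with y hy
      exact h1 y hy.le
    rw [this.fderiv_eq]; simp
  · apply hx
    have : (fun x => ((f x : ℝ) : ℂ)) =ᶠ[nhds x] fun _ => 0 := by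
      filter_upwards [continuous_norm.continuousAt.eventually_const_lt h] with y hy
      rw [f.zero_of_le_dist (by simpa [f] using hy.le)]; simp
    rw [this.fderiv_eq]; simp

/-- In dimension at most two, balls have vanishing homogeneous capacity. -/
theorem exists_isTest_eq_one_energy_le {n : ℕ} (hn : n ≤ 2) : ∃ E : ℝ, ∀ R : ℝ, 1 ≤ R →
    ∀ N : ℕ, ∃ u : V n → ℂ, IsTest u ∧ (∀ x, ‖x‖ ≤ R → u x = 1) ∧
      ∫ x : V n, ‖fderiv ℝ u x‖ ^ 2 ≤ E / (N + 1) := by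
  obtain ⟨φ, hφ, hφ1, hφ2⟩ := exists_isTest_cutoff n
  refine ⟨∫ x : V n, ‖fderiv ℝ φ x‖ ^ 2, fun R hR N => ?_⟩
  set E := ∫ x : V n, ‖fderiv ℝ φ x‖ ^ 2
  let c : ℕ → ℝ := fun j => R * 4 ^ j
  have hRc : ∀ j, R ≤ c j := fun j =>
    le_mul_of_one_le_right (by linarith) (one_le_pow₀ (by norm_num))
  have hc0 : ∀ j, 0 < c j := fun j => by linarith [hRc j]
  let w : ℕ → V n → ℂ := fun j x => φ ((c j)⁻¹ • x)
  have hw : ∀ j, IsTest (w j) := fun j => hφ.comp_smul (inv_ne_zero (hc0 j).ne')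
  have hN : (0 : ℝ) < N + 1 := by positivity
  have hsum : IsTest fun x => ∑ j ∈ Finset.range (N + 1), w j x := IsTest.sum fun j _ => hw j
  refine ⟨fun x => ((N : ℝ) + 1)⁻¹ • ∑ j ∈ Finset.range (N + 1), w j x, hsum.const_smul _, ?_, ?_⟩
  · intro x hx
    have : ∀ j, w j x = 1 := fun j => hφ1 _ <| by
      rw [norm_smul, norm_inv, Real.norm_of_nonneg (hc0 j).le, inv_mul_le_iff₀ (hc0 j)]
      linarith [hRc j]
    simp only [this, Finset.sum_const, Finset.card_range, nsmul_eq_mul, mul_one, Complex.real_smul]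
    push_cast
    exact inv_mul_cancel₀ (by exact_mod_cast hN.ne')
  · have hsupp : ∀ j x, fderiv ℝ (w j) x ≠ 0 → c j ≤ ‖x‖ ∧ ‖x‖ ≤ 2 * c j := by
      intro j x hx
      rw [fderiv_comp_smul] at hx
      obtain ⟨h1, h2⟩ := hφ2 _ fun h => hx (by rw [h, smul_zero])
      rw [norm_smul, norm_inv, Real.norm_of_nonneg (hc0 j).le] at h1 h2
      rw [inv_mul_le_iff₀ (hc0 j)] at h2
      rw [le_inv_mul_iff₀ (hc0 j)] at h1
      constructor <;> linarith
    have hlt : ∀ x i j, i < j → fderiv ℝ (w i) x = 0 ∨ fderiv ℝ (w j) x = 0 := by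
      intro x i j hij
      by_contra! h
      have h1 := (hsupp i x h.1).2
      have h2 := (hsupp j x h.2).1
      have h3 : c (i + 1) ≤ c j :=
        mul_le_mul_of_nonneg_left (pow_le_pow_right₀ (by norm_num) hij) (by linarith)
      have h4 : c (i + 1) = 4 * c i := by simp only [c]; ring
      linarith [hc0 i]
    have hpt : ∀ x, ‖fderiv ℝ (fun x => ((N : ℝ) + 1)⁻¹ • ∑ j ∈ Finset.range (N + 1), w j x) x‖ ^ 2
        ≤ (((N : ℝ) + 1)⁻¹) ^ 2 * ∑ j ∈ Finset.range (N + 1), ‖fderiv ℝ (w j) x‖ ^ 2 := by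
      intro x
      rw [fderiv_fun_const_smul (hsum.differentiable x),
        fderiv_fun_sum fun j _ => (hw j).differentiable x, norm_smul, mul_pow,
        Real.norm_of_nonneg (by positivity)]
      gcongr
      refine norm_sum_sq_le_of_pairwise_eq_zero _ _ fun i _ j _ hij => ?_
      rcases hij.lt_or_gt with h | h
      · exact hlt x i j h
      · exact (hlt x j i h).symm
    have hint : ∀ j ∈ Finset.range (N + 1), Integrable fun x => ‖fderiv ℝ (w j) x‖ ^ 2 :=
      fun j _ => (hw j).integrable_norm_fderiv_sq
    calc _ ≤ ∫ x, (((N : ℝ) + 1)⁻¹) ^ 2 * ∑ j ∈ Finset.range (N + 1), ‖fderiv ℝ (w j) x‖ ^ 2 :=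
          integral_mono (hsum.const_smul _).integrable_norm_fderiv_sq
            ((integrable_finsetSum _ hint).const_mul _) hpt
      _ = (((N : ℝ) + 1)⁻¹) ^ 2 * ∑ j ∈ Finset.range (N + 1), ∫ x, ‖fderiv ℝ (w j) x‖ ^ 2 := by
          rw [integral_const_mul, integral_finsetSum _ hint]
      _ ≤ (((N : ℝ) + 1)⁻¹) ^ 2 * ∑ j ∈ Finset.range (N + 1), E := by
          gcongr with j
          exact integral_norm_fderiv_sq_comp_inv_smul_le hn φ (hR.trans (hRc j))
      _ = E / (N + 1) := by
          simp only [Finset.sum_const, Finset.card_range, nsmul_eq_mul]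
          push_cast
          field_simp

/-- If `n ∈ {1, 2}` and a nonnegative locally finite Borel measure `μ` on `ℝⁿ`
satisfies `∫ |u|² dμ ≤ C ‖∇u‖²_{L²}` for all test functions `u`, then `μ = 0`. -/
theorem stmt_1 (n : ℕ) (hn : n = 1 ∨ n = 2) (C : ℝ) (μ : Measure (V n))
    [IsLocallyFiniteMeasure μ]
    (hμ : ∀ u : V n → ℂ, IsTest u →
      ∫ x, ‖u x‖ ^ 2 ∂μ ≤ C * ∫ x : V n, ‖fderiv ℝ u x‖ ^ 2) :
    μ = 0 := by
  obtain ⟨E, hE⟩ := exists_isTest_eq_one_energy_le (n := n) (by omega)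
  have hball : ∀ R : ℝ, 1 ≤ R → μ (Metric.closedBall 0 R) = 0 := by
    intro R hR
    have hfin : μ (Metric.closedBall 0 R) ≠ ⊤ := (isCompact_closedBall 0 R).measure_ne_top
    have hle : ∀ N : ℕ, μ.real (Metric.closedBall 0 R) ≤ |C| * E / (N + 1) := by
      intro N
      obtain ⟨u, hu, hu1, huE⟩ := hE R hR N
      have hint := hu.integrable_norm_sq μ
      calc μ.real (Metric.closedBall 0 R)
          = ∫ x in Metric.closedBall 0 R, ‖u x‖ ^ 2 ∂μ := by
            rw [setIntegral_congr_fun (g := fun _ => (1 : ℝ)) measurableSet_closedBall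
              fun x hx => by simp [hu1 x (by simpa using hx)]]
            simp
        _ ≤ ∫ x, ‖u x‖ ^ 2 ∂μ :=
            setIntegral_le_integral hint (.of_forall fun x => by positivity)
        _ ≤ C * ∫ x : V n, ‖fderiv ℝ u x‖ ^ 2 := hμ u hu
        _ ≤ |C| * ∫ x : V n, ‖fderiv ℝ u x‖ ^ 2 :=
            mul_le_mul_of_nonneg_right (le_abs_self C) (integral_nonneg fun x => by positivity)
        _ ≤ |C| * (E / (N + 1)) := by gcongr
        _ = |C| * E / (N + 1) := by ring
    have hlim : Filter.Tendsto (fun N : ℕ => |C| * E / ((N : ℝ) + 1)) Filter.atTop (nhds 0) := by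
      simpa [div_eq_mul_inv] using
        tendsto_one_div_add_atTop_nhds_zero_nat.const_mul (|C| * E)
    exact (measureReal_eq_zero_iff hfin).1
      (le_antisymm (ge_of_tendsto' hlim hle) measureReal_nonneg)
  rw [← Measure.measure_univ_eq_zero, ← Metric.iUnion_closedBall_nat (0 : V n)]
  refine measure_iUnion_null fun k => measure_mono_null ?_ (hball (max 1 k) (le_max_left _ _))
  exact Metric.closedBall_subset_closedBall (le_max_right _ _)
end
end
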